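/- arXiv:2512.00405 — 7 statements merged into one kernel-verified Lean document; each statement's English description precedes it below -/
import Mathlib

section
/- For all real numbers τ, τ̂, q, q̂: |1(τ̂ > q̂)·1(τ̂ > 0) − 1(τ > q)·1(τ > 0)| ≤ 1(|τ − q| ≤ |τ̂ − τ| + |q̂ − q|) + 1(|τ| ≤ |τ̂ − τ|). -/
/-- If `b` is within distance `r` of `a` and `|a|` exceeds `r`, then `a` and `b` are positive
together. -/
theorem pos_iff_pos_of_abs_sub_lt {a b r : ℝ} (hab : |b - a| ≤ r) (ha : r < |a|) :
    0 < b ↔ 0 < a := by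
  obtain ⟨h₁, h₂⟩ := abs_le.mp hab
  rcases lt_abs.mp ha with h | h
  · exact ⟨fun _ => by linarith, fun _ => by linarith⟩
  · exact ⟨fun _ => by linarith, fun _ => by linarith⟩

/-- For all real numbers `τ, τ̂, q, q̂`:
`|1(τ̂ > q̂)·1(τ̂ > 0) − 1(τ > q)·1(τ > 0)|
  ≤ 1(|τ − q| ≤ |τ̂ − τ| + |q̂ − q|) + 1(|τ| ≤ |τ̂ − τ|)`. -/
theorem indicator_threshold_policy_diff_le (τ τhat q qhat : ℝ) :
    |(if qhat < τhat then (1 : ℝ) else 0) * (if 0 < τhat then (1 : ℝ) else 0) -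
        (if q < τ then (1 : ℝ) else 0) * (if 0 < τ then (1 : ℝ) else 0)| ≤
      (if |τ - q| ≤ |τhat - τ| + |qhat - q| then (1 : ℝ) else 0) +
        (if |τ| ≤ |τhat - τ| then (1 : ℝ) else 0) := by
  have hq : ¬|τ - q| ≤ |τhat - τ| + |qhat - q| → (qhat < τhat ↔ q < τ) := fun h => by
    have hd : |(τhat - qhat) - (τ - q)| ≤ |τhat - τ| + |qhat - q| := by
      rw [sub_sub_sub_comm]
      exact abs_sub _ _
    simpa only [sub_pos] using pos_iff_pos_of_abs_sub_lt hd (not_le.mp h)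
  have hτ : ¬|τ| ≤ |τhat - τ| → (0 < τhat ↔ 0 < τ) := fun h =>
    pos_iff_pos_of_abs_sub_lt le_rfl (not_le.mp h)
  by_cases hA : |τ - q| ≤ |τhat - τ| + |qhat - q|
  · rw [if_pos hA]
    split_ifs <;> norm_num
  · by_cases hB : |τ| ≤ |τhat - τ|
    · rw [if_pos hB]
      split_ifs <;> norm_num
    · simp [hq hA, hτ hB, hA, hB]
end

section
/- Let (𝒳, 𝒜, μ) be a probability space, let τ and τ̂ be real-valued measurable functions on 𝒳, and let q, q̂ be real numbers. Define the policies π(x) = 1(τ(x) > q)·1(τ(x) > 0) and π̂(x) = 1(τ̂(x) > q̂)·1(τ̂(x) > 0). Then ∫ (π̂ − π)² dμ ≤ μ({x : |τ(x) − q| ≤ |τ̂(x) − τ(x)| + |q̂ − q|}) + μ({x : |τ(x)| ≤ |τ̂(x) − τ(x)|}). -/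
open MeasureTheory

/-- Two products of threshold indicators can differ only where the perturbation crosses one of the
two thresholds. -/
theorem sq_threshold_diff_le (t s q r : ℝ) :
    ((if r < s then (1 : ℝ) else 0) * (if 0 < s then (1 : ℝ) else 0) -
        (if q < t then (1 : ℝ) else 0) * (if 0 < t then (1 : ℝ) else 0)) ^ 2 ≤
      (if |t - q| ≤ |s - t| + |r - q| then (1 : ℝ) else 0) +
        (if |t| ≤ |s - t| then (1 : ℝ) else 0) := by
  have hq : ¬ |t - q| ≤ |s - t| + |r - q| → (r < s ↔ q < t) := by
    grind
  have h0 : ¬ |t| ≤ |s - t| → (0 < s ↔ 0 < t) := by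
    grind
  split_ifs <;> first | (exfalso; tauto) | norm_num

/-- Let `(𝒳, 𝒜, μ)` be a probability space, `τ`, `τ̂` measurable, `q, q̂ ∈ ℝ`.
With `π(x) = 1(τ(x) > q)·1(τ(x) > 0)` and `π̂(x) = 1(τ̂(x) > q̂)·1(τ̂(x) > 0)`,
`∫ (π̂ − π)² dμ ≤ μ({|τ − q| ≤ |τ̂ − τ| + |q̂ − q|}) + μ({|τ| ≤ |τ̂ − τ|})`. -/
theorem policy_sq_diff_integral_le {𝒳 : Type*} [MeasurableSpace 𝒳]
    (μ : Measure 𝒳) [IsProbabilityMeasure μ]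
    (τ τhat : 𝒳 → ℝ) (hτ : Measurable τ) (hτhat : Measurable τhat)
    (q qhat : ℝ) :
    ∫ x, ((if qhat < τhat x then (1 : ℝ) else 0) * (if 0 < τhat x then (1 : ℝ) else 0) -
          (if q < τ x then (1 : ℝ) else 0) * (if 0 < τ x then (1 : ℝ) else 0)) ^ 2 ∂μ ≤
      (μ {x | |τ x - q| ≤ |τhat x - τ x| + |qhat - q|}).toReal +
        (μ {x | |τ x| ≤ |τhat x - τ x|}).toReal := by
  have hA : MeasurableSet {x | |τ x - q| ≤ |τhat x - τ x| + |qhat - q|} :=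
    measurableSet_le (by fun_prop) (by fun_prop)
  have hB : MeasurableSet {x | |τ x| ≤ |τhat x - τ x|} :=
    measurableSet_le (by fun_prop) (by fun_prop)
  have iA := (integrable_const (μ := μ) (1 : ℝ)).indicator hA
  have iB := (integrable_const (μ := μ) (1 : ℝ)).indicator hB
  refine (integral_mono_of_nonneg (.of_forall fun x => sq_nonneg _) (iA.add iB)
    (.of_forall fun x => ?_)).trans_eq ?_
  · simpa [Set.indicator_apply] using sq_threshold_diff_le (τ x) (τhat x) q qhat
  · simp only [Pi.add_apply]
    rw [integral_add iA iB, integral_indicator_const _ hA, integral_indicator_const _ hB]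
    simp [measureReal_def]
end

section
/- Let (𝒳, 𝒜, μ) be a probability space. Let τ_Y be a measurable function with |τ_Y| ≤ M μ-almost everywhere for some constant M > 0, and let τ_S, τ̂_S be measurable functions with |τ̂_S − τ_S| ≤ δ μ-almost everywhere for some δ ≥ 0. Assume the margin condition: there exist constants C > 0 and α > 0 such that μ({x : |τ_S(x)| ≤ t}) ≤ C·t^α for all t ≥ 0. Then ∫ |τ_Y| · |1(τ̂_S > 0) − 1(τ_S > 0)| dμ ≤ M·C·δ^α. -/
open MeasureTheory

/-- If the thresholding decisions of `a` and `b` at `0` differ and `|a - b| ≤ δ`, then `|b| ≤ δ`. -/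
theorem abs_le_of_pos_indicator_ne {a b δ : ℝ} (h : |a - b| ≤ δ)
    (hne : ¬(0 < a ↔ 0 < b)) : |b| ≤ δ := by
  rw [abs_le] at h ⊢
  by_cases ha : 0 < a <;> by_cases hb : 0 < b <;> simp only [ha, hb, not_true] at hne
  all_goals first
    | exact absurd Iff.rfl hne
    | constructor <;> linarith [h.1, h.2]

/-- Margin-condition bound: if `|τ_Y| ≤ M` a.e., `|τ̂_S − τ_S| ≤ δ` a.e., and
`μ({|τ_S| ≤ t}) ≤ C·t^α` for all `t ≥ 0`, then
`∫ |τ_Y|·|1(τ̂_S > 0) − 1(τ_S > 0)| dμ ≤ M·C·δ^α`. -/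
theorem surrogate_policy_bias_le {𝒳 : Type*} [MeasurableSpace 𝒳]
    (μ : Measure 𝒳) [IsProbabilityMeasure μ]
    (τY τS τShat : 𝒳 → ℝ)
    (hτY : Measurable τY) (hτS : Measurable τS) (hτShat : Measurable τShat)
    (M : ℝ) (hM : 0 < M) (hτYb : ∀ᵐ x ∂μ, |τY x| ≤ M)
    (δ : ℝ) (hδ : 0 ≤ δ) (hτSdiff : ∀ᵐ x ∂μ, |τShat x - τS x| ≤ δ)
    (C α : ℝ) (hC : 0 < C) (hα : 0 < α)
    (hmargin : ∀ t : ℝ, 0 ≤ t → (μ {x | |τS x| ≤ t}).toReal ≤ C * t ^ α) :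
    ∫ x, |τY x| * |(if 0 < τShat x then (1 : ℝ) else 0) -
        (if 0 < τS x then (1 : ℝ) else 0)| ∂μ ≤ M * C * δ ^ α := by
  have hmeas : MeasurableSet {x | |τS x| ≤ δ} :=
    measurableSet_le hτS.abs measurable_const
  calc
    _ ≤ ∫ x, {x | |τS x| ≤ δ}.indicator (fun _ => M) x ∂μ := by
      refine integral_mono_of_nonneg (ae_of_all _ fun x => by positivity)
        ((integrable_const M).indicator hmeas) ?_
      filter_upwards [hτYb, hτSdiff] with x hY hS
      by_cases hiff : 0 < τShat x ↔ 0 < τS x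
      · simpa [hiff] using Set.indicator_nonneg (fun _ _ => hM.le) x
      · have hmem : x ∈ {x | |τS x| ≤ δ} := abs_le_of_pos_indicator_ne hS hiff
        rw [Set.indicator_of_mem hmem]
        refine (mul_le_of_le_one_right (abs_nonneg _) ?_).trans hY
        split_ifs <;> norm_num
    _ = (μ {x | |τS x| ≤ δ}).toReal * M := by
      rw [integral_indicator_const M hmeas, smul_eq_mul, Measure.real]
    _ ≤ C * δ ^ α * M := mul_le_mul_of_nonneg_right (hmargin δ hδ) hM.le
    _ = M * C * δ ^ α := by ring
end

section
/- Let (𝒳, 𝒜, μ) be a probability space. Let τ and τ̂ be measurable functions with |τ̂ − τ| ≤ δ μ-almost everywhere for some δ ≥ 0. Assume the margin condition: there exist constants C > 0 and α > 0 such that μ({x : |τ(x)| ≤ t}) ≤ C·t^α for all t ≥ 0. Then ∫ |τ| · |1(τ > 0) − 1(τ̂ > 0)| dμ ≤ C·δ^(1+α). -/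
open MeasureTheory

/-- Margin-condition bound: if `|τ̂ − τ| ≤ δ` a.e. and `μ({|τ| ≤ t}) ≤ C·t^α`
for all `t ≥ 0`, then `∫ |τ|·|1(τ > 0) − 1(τ̂ > 0)| dμ ≤ C·δ^(1+α)`. -/
theorem optimal_policy_bias_le {𝒳 : Type*} [MeasurableSpace 𝒳]
    (μ : Measure 𝒳) [IsProbabilityMeasure μ]
    (τ τhat : 𝒳 → ℝ) (hτ : Measurable τ) (hτhat : Measurable τhat)
    (δ : ℝ) (hδ : 0 ≤ δ) (hτdiff : ∀ᵐ x ∂μ, |τhat x - τ x| ≤ δ)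
    (C α : ℝ) (hC : 0 < C) (hα : 0 < α)
    (hmargin : ∀ t : ℝ, 0 ≤ t → (μ {x | |τ x| ≤ t}).toReal ≤ C * t ^ α) :
    ∫ x, |τ x| * |(if 0 < τ x then (1 : ℝ) else 0) -
        (if 0 < τhat x then (1 : ℝ) else 0)| ∂μ ≤ C * δ ^ (1 + α) := by
  have hmeas : MeasurableSet {x | |τ x| ≤ δ} := measurableSet_le hτ.abs measurable_const
  calc _ ≤ ∫ x, {x | |τ x| ≤ δ}.indicator (fun _ => δ) x ∂μ := by
        refine integral_mono_of_nonneg (.of_forall fun x => by positivity)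
          ((integrable_const δ).indicator hmeas) ?_
        filter_upwards [hτdiff] with x hx
        have hx' := abs_le.mp hx
        by_cases h1 : 0 < τ x <;> by_cases h2 : 0 < τhat x
        · simpa [h1, h2] using Set.indicator_nonneg (fun _ _ => hδ) x
        · have h : |τ x| ≤ δ := abs_le.mpr ⟨by linarith, by linarith⟩
          simp [h1, h2, Set.indicator, h]
        · have h : |τ x| ≤ δ := abs_le.mpr ⟨by linarith, by linarith⟩
          simp [h1, h2, Set.indicator, h]
        · simpa [h1, h2] using Set.indicator_nonneg (fun _ _ => hδ) x
    _ = (μ {x | |τ x| ≤ δ}).toReal * δ := by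
        rw [integral_indicator_const _ hmeas, smul_eq_mul, Measure.real]
    _ ≤ C * δ ^ α * δ := mul_le_mul_of_nonneg_right (hmargin δ hδ) hδ
    _ = C * δ ^ (1 + α) := by
        rw [Real.rpow_add_of_nonneg hδ zero_le_one hα.le, Real.rpow_one]
        ring
end

section
/- Let (𝒳, 𝒜, μ) be a probability space. Let τ be a measurable function with |τ| ≤ M μ-almost everywhere for some constant M > 0, let τ̂ be measurable with |τ̂ − τ| ≤ δ μ-almost everywhere for some δ ≥ 0, and let q, q̂ be real numbers. Assume the two margin conditions: there exist constants C₁ > 0, α > 0 with μ({|τ| ≤ t}) ≤ C₁·t^α for all t ≥ 0, and constants C₂ > 0, β > 0 with μ({|τ − q| ≤ t}) ≤ C₂·t^β for all t ≥ 0. Define π(x) = 1(τ(x) > q)·1(τ(x) > 0) and π̂(x) = 1(τ̂(x) > q̂)·1(τ̂(x) > 0). Then ∫ |τ| · |π − π̂| dμ ≤ C₁·δ^(1+α) + M·C₂·(δ + |q̂ − q|)^β. -/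
open MeasureTheory

/-- Pointwise bound: two thresholding policies disagree only where `τ` is close to `0`
or close to the cutoff `q`. -/
theorem abs_mul_abs_policy_sub_le {𝒳 : Type*} {τ τhat : 𝒳 → ℝ} {M δ q qhat : ℝ} {x : 𝒳}
    (hM : 0 ≤ M) (hδ : 0 ≤ δ) (hb : |τ x| ≤ M) (hd : |τhat x - τ x| ≤ δ) :
    |τ x| *
        |(if q < τ x then (1 : ℝ) else 0) * (if 0 < τ x then (1 : ℝ) else 0) -
          (if qhat < τhat x then (1 : ℝ) else 0) * (if 0 < τhat x then (1 : ℝ) else 0)| ≤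
      {x | |τ x| ≤ δ}.indicator (fun _ => δ) x +
        {x | |τ x - q| ≤ δ + |qhat - q|}.indicator (fun _ => M) x := by
  have hA : 0 ≤ {x | |τ x| ≤ δ}.indicator (fun _ => δ) x :=
    Set.indicator_nonneg (fun _ _ => hδ) x
  have hB : 0 ≤ {x | |τ x - q| ≤ δ + |qhat - q|}.indicator (fun _ => M) x :=
    Set.indicator_nonneg (fun _ _ => hM) x
  have hle : |(if q < τ x then (1 : ℝ) else 0) * (if 0 < τ x then (1 : ℝ) else 0) -
      (if qhat < τhat x then (1 : ℝ) else 0) * (if 0 < τhat x then (1 : ℝ) else 0)| ≤ 1 := by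
    split_ifs <;> norm_num
  have hτ := mul_le_of_le_one_right (abs_nonneg (τ x)) hle
  by_cases h₀ : |τ x| ≤ δ
  · rw [Set.indicator_of_mem (s := {x | |τ x| ≤ δ}) h₀] at *
    linarith
  by_cases h₁ : |τ x - q| ≤ δ + |qhat - q|
  · rw [Set.indicator_of_mem (s := {x | |τ x - q| ≤ δ + |qhat - q|}) h₁] at *
    linarith
  have hzero : 0 < τ x ↔ 0 < τhat x := by grind
  have hcut : q < τ x ↔ qhat < τhat x := by grind
  simp only [hzero, hcut, sub_self, abs_zero, mul_zero]
  exact add_nonneg hA hB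

/-- Budget-constrained margin bound for the outcome policy: with `|τ| ≤ M` a.e.,
`|τ̂ − τ| ≤ δ` a.e., margin conditions `μ({|τ| ≤ t}) ≤ C₁·t^α` and
`μ({|τ − q| ≤ t}) ≤ C₂·t^β` for all `t ≥ 0`, and policies
`π(x) = 1(τ(x) > q)·1(τ(x) > 0)`, `π̂(x) = 1(τ̂(x) > q̂)·1(τ̂(x) > 0)`, we have
`∫ |τ|·|π − π̂| dμ ≤ C₁·δ^(1+α) + M·C₂·(δ + |q̂ − q|)^β`. -/
theorem budget_policy_bias_le {𝒳 : Type*} [MeasurableSpace 𝒳]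
    (μ : Measure 𝒳) [IsProbabilityMeasure μ]
    (τ τhat : 𝒳 → ℝ) (hτ : Measurable τ) (hτhat : Measurable τhat)
    (M : ℝ) (hM : 0 < M) (hτb : ∀ᵐ x ∂μ, |τ x| ≤ M)
    (δ : ℝ) (hδ : 0 ≤ δ) (hτdiff : ∀ᵐ x ∂μ, |τhat x - τ x| ≤ δ)
    (q qhat : ℝ)
    (C₁ α : ℝ) (hC₁ : 0 < C₁) (hα : 0 < α)
    (hmargin₁ : ∀ t : ℝ, 0 ≤ t → (μ {x | |τ x| ≤ t}).toReal ≤ C₁ * t ^ α)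
    (C₂ β : ℝ) (hC₂ : 0 < C₂) (hβ : 0 < β)
    (hmargin₂ : ∀ t : ℝ, 0 ≤ t → (μ {x | |τ x - q| ≤ t}).toReal ≤ C₂ * t ^ β) :
    ∫ x, |τ x| *
        |(if q < τ x then (1 : ℝ) else 0) * (if 0 < τ x then (1 : ℝ) else 0) -
          (if qhat < τhat x then (1 : ℝ) else 0) * (if 0 < τhat x then (1 : ℝ) else 0)| ∂μ ≤
      C₁ * δ ^ (1 + α) + M * C₂ * (δ + |qhat - q|) ^ β := by
  set r := δ + |qhat - q|
  have hr0 : 0 ≤ r := by positivity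
  have hA : MeasurableSet {x | |τ x| ≤ δ} := by measurability
  have hB : MeasurableSet {x | |τ x - q| ≤ r} := by measurability
  have hAi : Integrable ({x | |τ x| ≤ δ}.indicator fun _ => δ) μ :=
    (integrable_const δ).indicator hA
  have hBi : Integrable ({x | |τ x - q| ≤ r}.indicator fun _ => M) μ :=
    (integrable_const M).indicator hB
  calc
    _ ≤ ∫ x, ({x | |τ x| ≤ δ}.indicator (fun _ => δ) x +
          {x | |τ x - q| ≤ r}.indicator (fun _ => M) x) ∂μ := by
      refine integral_mono_of_nonneg (ae_of_all _ fun x => by positivity) (hAi.add hBi) ?_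
      filter_upwards [hτb, hτdiff] with x hb hd
      exact abs_mul_abs_policy_sub_le hM.le hδ hb hd
    _ = μ.real {x | |τ x| ≤ δ} * δ + μ.real {x | |τ x - q| ≤ r} * M := by
      rw [integral_add hAi hBi, integral_indicator_const _ hA, integral_indicator_const _ hB,
        smul_eq_mul, smul_eq_mul]
    _ ≤ C₁ * δ ^ α * δ + C₂ * r ^ β * M :=
      add_le_add (mul_le_mul_of_nonneg_right (hmargin₁ δ hδ) hδ)
        (mul_le_mul_of_nonneg_right (hmargin₂ r hr0) hM.le)
    _ = C₁ * δ ^ (1 + α) + M * C₂ * r ^ β := by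
      rw [Real.rpow_add_of_nonneg hδ zero_le_one hα.le, Real.rpow_one]
      ring
end

section
/- Let (𝒳, 𝒜, μ) be a probability space. Let τ_Y be a measurable function with |τ_Y| ≤ M μ-almost everywhere for some constant M > 0. Let τ_S be measurable, let τ̂_S be measurable with |τ̂_S − τ_S| ≤ δ μ-almost everywhere for some δ ≥ 0, and let s, ŝ be real numbers. Assume the two margin conditions: there exist constants C₁ > 0, α > 0 with μ({|τ_S| ≤ t}) ≤ C₁·t^α for all t ≥ 0, and constants C₂ > 0, β > 0 with μ({|τ_S − s| ≤ t}) ≤ C₂·t^β for all t ≥ 0. Define π(x) = 1(τ_S(x) > s)·1(τ_S(x) > 0) and π̂(x) = 1(τ̂_S(x) > ŝ)·1(τ̂_S(x) > 0). Then ∫ |τ_Y| · |π − π̂| dμ ≤ M·C₁·δ^α + M·C₂·(δ + |ŝ − s|)^β. -/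
open MeasureTheory

/-- Thresholding at `0` and at `s` (resp. `t`) treats the nearby points `a` and `b` alike, unless `a`
is close to one of the cutoffs `0` and `s`. -/
theorem abs_threshold_sub_threshold_le {a b s t δ : ℝ} (hab : |b - a| ≤ δ) :
    |(if s < a then (1 : ℝ) else 0) * (if 0 < a then (1 : ℝ) else 0) -
        (if t < b then (1 : ℝ) else 0) * (if 0 < b then (1 : ℝ) else 0)| ≤
      (if |a| ≤ δ then (1 : ℝ) else 0) + (if |a - s| ≤ δ + |t - s| then (1 : ℝ) else 0) := by
  have sign_close : ¬ |a| ≤ δ → (0 < a ↔ 0 < b) := by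
    intro h
    rw [abs_le] at h hab
    constructor <;> intro h' <;> by_contra hc <;> exact h ⟨by linarith, by linarith⟩
  have cutoff_close : ¬ |a - s| ≤ δ + |t - s| → (s < a ↔ t < b) := by
    intro h
    have h₁ := le_abs_self (t - s)
    have h₂ := neg_abs_le (t - s)
    have h₃ := abs_nonneg (t - s)
    rw [abs_le] at h hab
    constructor <;> intro h' <;> by_contra hc <;> exact h ⟨by linarith, by linarith⟩
  by_cases h₁ : |a| ≤ δ
  · rw [if_pos h₁]
    split_ifs <;> norm_num
  · by_cases h₂ : |a - s| ≤ δ + |t - s|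
    · rw [if_pos h₂]
      split_ifs <;> norm_num
    · simp only [sign_close h₁, cutoff_close h₂, h₁, h₂]
      simp

/-- Budget-constrained margin bound for the surrogate policy: with `|τ_Y| ≤ M` a.e.,
`|τ̂_S − τ_S| ≤ δ` a.e., margin conditions `μ({|τ_S| ≤ t}) ≤ C₁·t^α` and
`μ({|τ_S − s| ≤ t}) ≤ C₂·t^β` for all `t ≥ 0`, and policies
`π(x) = 1(τ_S(x) > s)·1(τ_S(x) > 0)`, `π̂(x) = 1(τ̂_S(x) > ŝ)·1(τ̂_S(x) > 0)`, we have
`∫ |τ_Y|·|π − π̂| dμ ≤ M·C₁·δ^α + M·C₂·(δ + |ŝ − s|)^β`. -/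
theorem budget_surrogate_policy_bias_le {𝒳 : Type*} [MeasurableSpace 𝒳]
    (μ : Measure 𝒳) [IsProbabilityMeasure μ]
    (τY τS τShat : 𝒳 → ℝ)
    (hτY : Measurable τY) (hτS : Measurable τS) (hτShat : Measurable τShat)
    (M : ℝ) (hM : 0 < M) (hτYb : ∀ᵐ x ∂μ, |τY x| ≤ M)
    (δ : ℝ) (hδ : 0 ≤ δ) (hτSdiff : ∀ᵐ x ∂μ, |τShat x - τS x| ≤ δ)
    (s shat : ℝ)
    (C₁ α : ℝ) (hC₁ : 0 < C₁) (hα : 0 < α)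
    (hmargin₁ : ∀ t : ℝ, 0 ≤ t → (μ {x | |τS x| ≤ t}).toReal ≤ C₁ * t ^ α)
    (C₂ β : ℝ) (hC₂ : 0 < C₂) (hβ : 0 < β)
    (hmargin₂ : ∀ t : ℝ, 0 ≤ t → (μ {x | |τS x - s| ≤ t}).toReal ≤ C₂ * t ^ β) :
    ∫ x, |τY x| *
        |(if s < τS x then (1 : ℝ) else 0) * (if 0 < τS x then (1 : ℝ) else 0) -
          (if shat < τShat x then (1 : ℝ) else 0) * (if 0 < τShat x then (1 : ℝ) else 0)| ∂μ ≤
      M * C₁ * δ ^ α + M * C₂ * (δ + |shat - s|) ^ β := by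
  have hA : MeasurableSet {x | |τS x| ≤ δ} := measurableSet_le (by fun_prop) measurable_const
  have hB : MeasurableSet {x | |τS x - s| ≤ δ + |shat - s|} :=
    measurableSet_le (by fun_prop) measurable_const
  set A := {x | |τS x| ≤ δ} with hA_def
  set B := {x | |τS x - s| ≤ δ + |shat - s|} with hB_def
  have hiA : Integrable (A.indicator fun _ => M) μ := (integrable_const M).indicator hA
  have hiB : Integrable (B.indicator fun _ => M) μ := (integrable_const M).indicator hB
  calc
    _ ≤ ∫ x, (A.indicator (fun _ => M) x + B.indicator (fun _ => M) x) ∂μ := by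
      refine integral_mono_of_nonneg (.of_forall fun x => by positivity) (hiA.add hiB) ?_
      filter_upwards [hτYb, hτSdiff] with x hx hd
      refine (mul_le_mul hx (abs_threshold_sub_threshold_le hd) (abs_nonneg _) hM.le).trans_eq ?_
      simp only [Set.indicator_apply, hA_def, hB_def, Set.mem_ofPred_eq, mul_add, mul_ite, mul_one,
        mul_zero]
    _ = M * (μ A).toReal + M * (μ B).toReal := by
      rw [integral_add hiA hiB, integral_indicator_const _ hA, integral_indicator_const _ hB]
      simp only [Measure.real, smul_eq_mul, mul_comm]
    _ ≤ M * C₁ * δ ^ α + M * C₂ * (δ + |shat - s|) ^ β := by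
      rw [mul_assoc, mul_assoc]
      gcongr
      · exact hmargin₁ δ hδ
      · exact hmargin₂ _ (by positivity)
end

section
/- Let (𝒳, 𝒜, μ) be a probability space, τ: 𝒳 → ℝ an integrable function, and c ≥ 0 a real number. Then for every measurable function π: 𝒳 → [0,1] satisfying the budget constraint ∫ π dμ ≤ μ({x : τ(x) > c}), it holds that ∫ τ·π dμ ≤ ∫ τ·1(τ > c) dμ. In words: among all fractional policies whose expected treatment fraction does not exceed the mass of the set {τ > c}, the thresholding policy 1(τ > c) maximizes the expected treatment effect. -/
open MeasureTheory

/-- λ-optimality of the thresholding policy: on a probability space, for integrable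
`τ` and `c ≥ 0`, every measurable fractional policy `π : 𝒳 → [0,1]` with
`∫ π dμ ≤ μ({τ > c})` satisfies `∫ τ·π dμ ≤ ∫ τ·1(τ > c) dμ`. -/
theorem threshold_policy_budget_optimal {𝒳 : Type*} [MeasurableSpace 𝒳]
    (μ : Measure 𝒳) [IsProbabilityMeasure μ]
    (τ : 𝒳 → ℝ) (hτ : Integrable τ μ)
    (c : ℝ) (hc : 0 ≤ c)
    (π : 𝒳 → ℝ) (hπ : Measurable π) (hπ01 : ∀ x, π x ∈ Set.Icc (0 : ℝ) 1)
    (hbudget : ∫ x, π x ∂μ ≤ (μ {x | c < τ x}).toReal) :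
    ∫ x, τ x * π x ∂μ ≤ ∫ x, τ x * (if c < τ x then (1 : ℝ) else 0) ∂μ := by
  have hs : NullMeasurableSet {x | c < τ x} μ :=
    nullMeasurableSet_lt aemeasurable_const hτ.aemeasurable
  have hind : (fun x => if c < τ x then (1 : ℝ) else 0)
      = {x | c < τ x}.indicator (fun _ => (1 : ℝ)) := by
    ext x
    simp [Set.indicator_apply]
  have hg : Integrable (fun x => if c < τ x then (1 : ℝ) else 0) μ := by
    rw [hind]
    exact (integrable_const (1 : ℝ)).indicator₀ hs
  have hgint : ∫ x, (if c < τ x then (1 : ℝ) else 0) ∂μ = (μ {x | c < τ x}).toReal := by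
    rw [hind, integral_indicator₀ hs]
    simp [Measure.real]
  have hπbound : ∀ᵐ x ∂μ, ‖π x‖ ≤ 1 := .of_forall fun x => by
    rw [Real.norm_of_nonneg (hπ01 x).1]
    exact (hπ01 x).2
  have hπint : Integrable π μ :=
    (integrable_const (1 : ℝ)).mono' hπ.aestronglyMeasurable hπbound
  have hτπ : Integrable (fun x => τ x * π x) μ :=
    hτ.mul_bdd hπ.aestronglyMeasurable hπbound
  have hτg : Integrable (fun x => τ x * (if c < τ x then (1 : ℝ) else 0)) μ :=
    hτ.mul_bdd (c := 1) hg.aestronglyMeasurable (.of_forall fun x => by split_ifs <;> simp)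
  have hmono : ∫ x, (τ x * π x - c * π x) ∂μ
      ≤ ∫ x, (τ x * (if c < τ x then (1 : ℝ) else 0)
        - c * (if c < τ x then (1 : ℝ) else 0)) ∂μ := by
    refine integral_mono (hτπ.sub (hπint.const_mul c)) (hτg.sub (hg.const_mul c)) fun x => ?_
    obtain ⟨h0, h1⟩ := hπ01 x
    dsimp only
    split_ifs with h
    · nlinarith
    · nlinarith
  rw [integral_sub hτπ (hπint.const_mul c), integral_sub hτg (hg.const_mul c),
    integral_const_mul, integral_const_mul, hgint] at hmono
  linarith [mul_le_mul_of_nonneg_left hbudget hc]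
end
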